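/- Let C be a smooth projective plane curve of degree d ≥ 5 over a number field k. Then C is neither hyperelliptic over k nor bielliptic over k. -/

import Mathlib

open MvPolynomial

set_option synthInstance.maxHeartbeats 400000
set_option maxHeartbeats 1000000

noncomputable section

/-- `F` defines a smooth projective plane curve of degree `d` over `k`: it is homogeneous of
degree `d` and, over the algebraic closure of `k`, `F` and its partial derivatives have no
common nontrivial zero (the Jacobian criterion for smoothness of the plane curve `F = 0`). -/
def IsSmoothPlaneCurve {k : Type} [Field k] (d : ℕ) (F : MvPolynomial (Fin 3) k) : Prop :=
  F.IsHomogeneous d ∧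
    ∀ P : Fin 3 → AlgebraicClosure k, P ≠ 0 →
      ∃ i : Fin 3, eval P (map (algebraMap k (AlgebraicClosure k)) (pderiv i F)) ≠ 0

/-- The affine coordinate ring of the plane curve `F = 0`, obtained by dehomogenizing at
`Z = 1`. Its fraction field is the function field of the curve. -/
abbrev PlaneCurveRing (k : Type) [Field k] (F : MvPolynomial (Fin 3) k) : Type :=
  MvPolynomial (Fin 2) k ⧸
    Ideal.span {(aeval ![X 0, X 1, 1] F : MvPolynomial (Fin 2) k)}

/-- The curve with function field `L` is hyperelliptic over `k`: it admits a `k`-morphism of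
degree two to the projective line, i.e. `L` has a rational subfield `k(x)` of index `2`. -/
def IsHyperellipticOver (k L : Type) [Field k] [Field L] [Algebra k L] : Prop :=
  ∃ x : L, Transcendental k x ∧
    Module.finrank (IntermediateField.adjoin k {x}) L = 2

/-- The curve with function field `L` is bielliptic over `k`: there is an elliptic curve `W`
over `k` (a Weierstrass curve with `Δ ≠ 0`) and a `k`-embedding of its function field into `L`
of index `2` (i.e. a degree-two `k`-morphism from the curve to `W`). -/
def IsBiellipticOver (k L : Type) [Field k] [Field L] [Algebra k L] : Prop :=
  ∃ W : WeierstrassCurve k, W.Δ ≠ 0 ∧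
    ∃ φ : W.toAffine.FunctionField →ₐ[k] L, Module.finrank φ.fieldRange L = 2

section ValuationSubring

variable {k L : Type*} [Field k] [Field L] [Algebra k L]

theorem isIntegral_of_forall_mem_valuationSubring {z : L}
    (h : ∀ O : ValuationSubring L, (∀ a : k, algebraMap k L a ∈ O) → z ∈ O) : IsIntegral k z := by
  have hz : z ∈ (integralClosure (Subring.closure (Set.range (algebraMap k L))) L).toSubring := by
    rw [← iInf_valuationSubring_superset]
    simp only [Subring.mem_iInf]
    rintro ⟨V, hV⟩
    exact h V fun a => hV ⟨a, rfl⟩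
  have hz' : IsIntegral (Subring.closure (Set.range (algebraMap k L))) z := hz
  have hc : Subring.closure (Set.range (algebraMap k L)) = (algebraMap k L).range := by
    rw [← RingHom.coe_range, Subring.closure_eq]
  rw [hc] at hz'
  obtain ⟨p, hp, hpz⟩ := hz'
  have hlift : p ∈ Polynomial.lifts (algebraMap k L).rangeRestrict := by
    rw [Polynomial.mem_lifts]
    exact Polynomial.map_surjective _ (algebraMap k L).rangeRestrict_surjective p
  obtain ⟨q, hq, -, hqm⟩ := Polynomial.lifts_and_degree_eq_and_monic hlift hp
  refine ⟨q, hqm, ?_⟩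
  rw [← hq, Polynomial.eval₂_map] at hpz
  exact hpz

variable {O : ValuationSubring L}

theorem ValuationSubring.one_add_ne_zero_and_inv_mem {a : L} (ha : O.valuation a < 1) :
    1 + a ≠ 0 ∧ (1 + a)⁻¹ ∈ O := by
  have h1 : O.valuation (1 + a) = 1 := Valuation.map_one_add_of_lt _ ha
  refine ⟨fun h => by simp [h] at h1, ?_⟩
  rw [← O.valuation_le_one_iff, map_inv₀, h1, inv_one]

theorem ValuationSubring.valuation_inv_lt_one {a : L} (ha : a ∉ O) : O.valuation a⁻¹ < 1 := by
  rw [← O.valuation_le_one_iff, not_le] at ha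
  rw [map_inv₀]
  exact inv_lt_one_of_one_lt₀ ha

theorem ValuationSubring.inv_mem_of_not_mem {a : L} (ha : a ∉ O) : a⁻¹ ∈ O :=
  (O.mem_or_inv_mem a).resolve_left ha

/-- If `z` is integral at a place but its conjugate `z'` is not, then a derivation preserving the
integrality of symmetric functions of `z, z'` preserves the integrality of `z`. -/
theorem Derivation.apply_mem_of_conj_not_mem (D : Derivation k L L) {z z' : L} (hz : z ∈ O)
    (hz' : z' ∉ O) (h1 : (z + z')⁻¹ ∈ O → D (z + z')⁻¹ ∈ O)
    (h2 : z * z' * (z + z')⁻¹ ∈ O → D (z * z' * (z + z')⁻¹) ∈ O) : D z ∈ O := by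
  have hz0 : z' ≠ 0 := fun h => hz' (h ▸ O.zero_mem)
  have hw := ValuationSubring.valuation_inv_lt_one hz'
  have hwO := ValuationSubring.inv_mem_of_not_mem hz'
  have hzw : O.valuation (z * z'⁻¹) < 1 := by
    rw [map_mul]
    exact mul_lt_one_of_nonneg_of_lt_one_right ((O.valuation_le_one_iff z).2 hz) zero_le hw
  obtain ⟨hu, huO⟩ := ValuationSubring.one_add_ne_zero_and_inv_mem hzw
  have hS : z + z' = z' * (1 + z * z'⁻¹) := by field_simp; ring
  have hS0 : z + z' ≠ 0 := by rw [hS]; exact mul_ne_zero hz0 hu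
  have hτ : (z + z')⁻¹ = z'⁻¹ * (1 + z * z'⁻¹)⁻¹ := by rw [hS, mul_inv]
  have hν : z * z' * (z + z')⁻¹ = z * (1 + z * z'⁻¹)⁻¹ := by rw [hS]; field_simp
  have hτO : (z + z')⁻¹ ∈ O := hτ ▸ O.mul_mem _ _ hwO huO
  have hνO : z * z' * (z + z')⁻¹ ∈ O := hν ▸ O.mul_mem _ _ hz huO
  have hτv : O.valuation (-(2 * (z + z')⁻¹ * z)) < 1 := by
    have h3 : 2 * (1 + z * z'⁻¹)⁻¹ ∈ O :=
      O.mul_mem _ _ (by simp) huO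
    rw [Valuation.map_neg, hτ,
      show 2 * (z'⁻¹ * (1 + z * z'⁻¹)⁻¹) * z = (2 * (1 + z * z'⁻¹)⁻¹) * (z * z'⁻¹) by ring, map_mul]
    exact mul_lt_one_of_nonneg_of_lt_one_right ((O.valuation_le_one_iff _).2 h3) zero_le hzw
  obtain ⟨hv, hvO⟩ := ValuationSubring.one_add_ne_zero_and_inv_mem hτv
  have key : (z + z')⁻¹ * z ^ 2 - z + z * z' * (z + z')⁻¹ = 0 := by field_simp; ring
  set τ := (z + z')⁻¹
  set ν := z * z' * τ
  have hD := congrArg D key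
  simp only [map_add, map_sub, Derivation.leibniz, Derivation.leibniz_pow, map_zero, smul_eq_mul,
    nsmul_eq_mul] at hD
  have : D z = (D τ * z ^ 2 + D ν) * (1 + -(2 * τ * z))⁻¹ := by
    rw [eq_mul_inv_iff_mul_eq₀ hv]
    push_cast at hD
    linear_combination -hD
  rw [this]
  exact O.mul_mem _ _ (O.add_mem _ _ (O.mul_mem _ _ (h1 hτO) (pow_mem hz 2)) (h2 hνO)) hvO

/-- Anti-invariant elements: if `D` is integral on the invariants, then so is `a * D b`. -/
theorem Derivation.mul_apply_mem_of_sq_mem [NeZero (2 : L)] (D : Derivation k L L) {a b : L}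
    (h2 : (2 : L)⁻¹ ∈ O) (hb : D (b ^ 2) ∈ O) (ha : D (a ^ 2) ∈ O) (haO : a ∈ O)
    (he : ∀ e, a ≠ 0 → b = e * a → e ∈ O → D e ∈ O) :
    a * D b ∈ O := by
  by_cases hb0 : b = 0
  · simp [hb0]
  by_cases ha0 : a = 0
  · simp [ha0]
  have two : (2 : L) ≠ 0 := NeZero.ne 2
  rcases O.mem_or_inv_mem (a * b⁻¹) with h | h
  · have : a * D b = (a * b⁻¹) * (2⁻¹ * D (b ^ 2)) := by
      simp only [Derivation.leibniz_pow, smul_eq_mul, nsmul_eq_mul]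
      push_cast
      field_simp
    rw [this]
    exact O.mul_mem _ _ h (O.mul_mem _ _ h2 hb)
  · have hba : (a * b⁻¹)⁻¹ = b * a⁻¹ := by field_simp
    rw [hba] at h
    have hbe : b = (b * a⁻¹) * a := by field_simp
    have hDe := he _ ha0 hbe h
    have : a * D b = D (b * a⁻¹) * a ^ 2 + (b * a⁻¹) * (2⁻¹ * D (a ^ 2)) := by
      conv_lhs => rw [hbe]
      generalize b * a⁻¹ = e
      simp only [Derivation.leibniz, Derivation.leibniz_pow, smul_eq_mul, nsmul_eq_mul]
      push_cast
      field_simp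
      ring
    rw [this]
    exact O.add_mem _ _ (O.mul_mem _ _ hDe (pow_mem haO 2)) (O.mul_mem _ _ h (O.mul_mem _ _ h2 ha))

end ValuationSubring

section Involution

variable {k L : Type*} [Field k] [Field L] [Algebra k L] {O : ValuationSubring L}

theorem Derivation.mul_apply_add_conj_mem [NeZero (2 : L)] (D : Derivation k L L) (σ : L ≃ₐ[k] L)
    (hσ : ∀ z, σ (σ z) = z) (hD : ∀ z, σ (D z) = D (σ z)) (h2 : (2 : L)⁻¹ ∈ O)
    (hfix : ∀ w ∈ O, σ w = w → D w ∈ O) (hO : ∀ z ∈ O, σ z ∈ O) {a b : L} (ha : a ∈ O)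
    (hb : b ∈ O) : a * D b + σ (a * D b) ∈ O := by
  have two : (2 : L) ≠ 0 := NeZero.ne 2
  have half : σ (2⁻¹ : L) = 2⁻¹ := by rw [map_inv₀, map_ofNat]
  obtain ⟨a0, ha0⟩ : ∃ a0, a0 = 2⁻¹ * (a + σ a) := ⟨_, rfl⟩
  obtain ⟨a1, ha1⟩ : ∃ a1, a1 = 2⁻¹ * (a - σ a) := ⟨_, rfl⟩
  obtain ⟨b0, hb0⟩ : ∃ b0, b0 = 2⁻¹ * (b + σ b) := ⟨_, rfl⟩
  obtain ⟨b1, hb1⟩ : ∃ b1, b1 = 2⁻¹ * (b - σ b) := ⟨_, rfl⟩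
  have ha0O : a0 ∈ O := ha0 ▸ O.mul_mem _ _ h2 (O.add_mem _ _ ha (hO _ ha))
  have ha1O : a1 ∈ O := ha1 ▸ O.mul_mem _ _ h2 (sub_mem ha (hO _ ha))
  have hb0O : b0 ∈ O := hb0 ▸ O.mul_mem _ _ h2 (O.add_mem _ _ hb (hO _ hb))
  have hb1O : b1 ∈ O := hb1 ▸ O.mul_mem _ _ h2 (sub_mem hb (hO _ hb))
  have sa0 : σ a0 = a0 := by rw [ha0, map_mul, half, map_add, hσ, add_comm]
  have sb0 : σ b0 = b0 := by rw [hb0, map_mul, half, map_add, hσ, add_comm]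
  have sa1 : σ a1 = -a1 := by rw [ha1, map_mul, half, map_sub, hσ]; ring
  have sb1 : σ b1 = -b1 := by rw [hb1, map_mul, half, map_sub, hσ]; ring
  have ea : a = a0 + a1 := by rw [ha0, ha1]; field_simp; ring
  have eb : b = b0 + b1 := by rw [hb0, hb1]; field_simp; ring
  have hDb0 : σ (D b0) = D b0 := by rw [hD, sb0]
  have hDb1 : σ (D b1) = -D b1 := by rw [hD, sb1, Derivation.map_neg]
  have key : a * D b + σ (a * D b) = 2 * (a0 * D b0 + a1 * D b1) := by
    rw [ea, eb]
    simp only [map_add, map_mul, sa0, sa1, hDb0, hDb1]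
    ring
  rw [key]
  refine O.mul_mem _ _ (by simp) (O.add_mem _ _ (O.mul_mem _ _ ha0O (hfix _ hb0O sb0)) ?_)
  refine D.mul_apply_mem_of_sq_mem h2 (hfix _ (pow_mem hb1O 2) (by rw [map_pow, sb1, neg_sq]))
    (hfix _ (pow_mem ha1O 2) (by rw [map_pow, sa1, neg_sq])) ha1O fun e ha10 hbe he => ?_
  refine hfix _ he ?_
  have h := congrArg σ hbe
  rw [sb1, map_mul, sa1, hbe] at h
  exact mul_right_cancel₀ ha10 (by linear_combination h)

/-- The trace of a regular differential is regular, when `D` is dual to a generator of the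
regular differentials on the quotient by `σ`. -/
theorem Derivation.mem_of_fixed [NeZero (2 : L)] (D : Derivation k L L) (σ : L ≃ₐ[k] L)
    (hσ : ∀ z, σ (σ z) = z) (hD : ∀ z, σ (D z) = D (σ z)) (h2 : (2 : L)⁻¹ ∈ O)
    (hfix : ∀ w ∈ O, σ w = w → D w ∈ O) {a b a' b' w : L} (ha : a ∈ O) (hb : b ∈ O)
    (ha' : a' ∈ O) (hb' : b' ∈ O) (hw : w = a * D b + a' * D b') (hσw : σ w = w) : w ∈ O := by
  have two : (2 : L) ≠ 0 := NeZero.ne 2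
  by_cases hO : ∀ z ∈ O, σ z ∈ O
  · have : w = 2⁻¹ * ((a * D b + σ (a * D b)) + (a' * D b' + σ (a' * D b'))) := by
      rw [eq_inv_mul_iff_mul_eq₀ two, two_mul]
      conv_lhs => arg 2; rw [← hσw]
      rw [hw, map_add]; ring
    rw [this]
    exact O.mul_mem _ _ h2 (O.add_mem _ _ (D.mul_apply_add_conj_mem σ hσ hD h2 hfix hO ha hb)
      (D.mul_apply_add_conj_mem σ hσ hD h2 hfix hO ha' hb'))
  · push Not at hO
    obtain ⟨e, he, hse⟩ := hO
    have split : ∀ z ∈ O, σ z ∉ O → D z ∈ O := fun z hz hsz => by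
      have hs : σ (z + σ z)⁻¹ = (z + σ z)⁻¹ := by rw [map_inv₀, map_add, hσ, add_comm]
      refine D.apply_mem_of_conj_not_mem hz hsz (fun h => hfix _ h hs) (fun h => hfix _ h ?_)
      rw [map_mul, map_mul, hσ, hs, mul_comm (σ z)]
    have all : ∀ z ∈ O, D z ∈ O := fun z hz => by
      by_cases hsz : σ z ∈ O
      · have := split (z + e) (O.add_mem _ _ hz he) fun h => hse (by
          simpa using sub_mem h hsz)
        simpa using sub_mem this (split e he hse)
      · exact split z hz hsz
    rw [hw]
    exact O.add_mem _ _ (O.mul_mem _ _ ha (all b hb)) (O.mul_mem _ _ ha' (all b' hb'))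

/-- A derivation vanishing on the field fixed by an involution vanishes. -/
theorem Derivation.eq_zero_of_fixed (E : Derivation k L L) (σ : L ≃ₐ[k] L)
    (hσ : ∀ z, σ (σ z) = z) (hfix : ∀ w, σ w = w → E w = 0) (z : L) : E z = 0 := by
  by_cases hz : σ z = z
  · exact hfix z hz
  have h1 := hfix (z + σ z) (by rw [map_add, hσ, add_comm])
  have h2 := hfix (z * σ z) (by rw [map_mul, hσ, mul_comm])
  simp only [map_add, Derivation.leibniz, smul_eq_mul] at h1 h2
  have : (σ z - z) * E z = 0 := by linear_combination h2 - z * h1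
  exact (mul_eq_zero.1 this).resolve_left (sub_ne_zero.2 hz)

end Involution

section Rational

open IntermediateField

variable {k L : Type*} [Field k] [Field L] [Algebra k L] {O : ValuationSubring L}

theorem Derivation.eq_zero_of_mem_adjoin (E : Derivation k L L) {t z : L} (ht : E t = 0)
    (hz : z ∈ k⟮t⟯) : E z = 0 := by
  rw [mem_adjoin_simple_iff] at hz
  obtain ⟨r, s, rfl⟩ := hz
  simp [Derivation.leibniz_div, Derivation.map_aeval, ht]

theorem IntermediateField.exists_isCoprime_of_mem_adjoin_simple {t z : L} (hz : z ∈ k⟮t⟯) :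
    ∃ r s : Polynomial k, IsCoprime r s ∧ Polynomial.aeval t s ≠ 0 ∧
      z = Polynomial.aeval t r / Polynomial.aeval t s := by
  rw [mem_adjoin_simple_iff] at hz
  obtain ⟨r, s, rfl⟩ := hz
  by_cases hs : Polynomial.aeval t s = 0
  · exact ⟨0, 1, isCoprime_one_right, by simp, by simp [hs]⟩
  have hs0 : s ≠ 0 := fun h => hs (by simp [h])
  obtain ⟨r', s', hg, hcop⟩ : ∃ r' s', (∃ g, r = g * r' ∧ s = g * s') ∧ IsCoprime r' s' := by
    classical
    obtain ⟨r', hr'⟩ := EuclideanDomain.gcd_dvd_left r s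
    obtain ⟨s', hs'⟩ := EuclideanDomain.gcd_dvd_right r s
    refine ⟨r', s', ⟨_, hr', hs'⟩, ?_⟩
    have hg : EuclideanDomain.gcd r s ≠ 0 := fun h => hs0 (EuclideanDomain.gcd_eq_zero_iff.1 h).2
    refine ⟨EuclideanDomain.gcdA r s, EuclideanDomain.gcdB r s, mul_left_cancel₀ hg ?_⟩
    conv_rhs => rw [mul_one, EuclideanDomain.gcd_eq_gcd_ab]
    conv_rhs => arg 1; arg 1; rw [hr']
    conv_rhs => arg 2; arg 1; rw [hs']
    ring
  obtain ⟨g, rfl, rfl⟩ := hg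
  rw [map_mul] at hs
  refine ⟨r', s', hcop, right_ne_zero_of_mul hs, ?_⟩
  rw [map_mul, map_mul, mul_div_mul_left _ _ (left_ne_zero_of_mul hs)]

theorem ValuationSubring.aeval_mem (hk : ∀ a : k, algebraMap k L a ∈ O) {t : L} (ht : t ∈ O)
    (p : Polynomial k) : Polynomial.aeval t p ∈ O := by
  rw [Polynomial.aeval_eq_sum_range]
  refine sum_mem fun i _ => ?_
  rw [Algebra.smul_def]
  exact O.mul_mem _ _ (hk _) (pow_mem ht i)

theorem Derivation.apply_mem_of_mem_adjoin (hk : ∀ a : k, algebraMap k L a ∈ O)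
    (D : Derivation k L L) {t z : L} (ht : t ∈ O) (hDt : D t ∈ O) (hz : z ∈ k⟮t⟯)
    (hzO : z ∈ O) : D z ∈ O := by
  obtain ⟨r, s, ⟨a, b, hab⟩, hs, rfl⟩ := exists_isCoprime_of_mem_adjoin_simple hz
  have hinv : (Polynomial.aeval t s)⁻¹ ∈ O := by
    have h := congrArg (Polynomial.aeval t) hab
    rw [map_add, map_mul, map_mul, map_one] at h
    have : (Polynomial.aeval t s)⁻¹ = Polynomial.aeval t a *
        (Polynomial.aeval t r / Polynomial.aeval t s) + Polynomial.aeval t b := by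
      field_simp
      linear_combination -h
    rw [this]
    exact O.add_mem _ _ (O.mul_mem _ _ (O.aeval_mem hk ht a) hzO) (O.aeval_mem hk ht b)
  rw [Derivation.leibniz_div, Derivation.map_aeval, Derivation.map_aeval]
  simp only [smul_eq_mul]
  have hp := fun p : Polynomial k => O.aeval_mem hk ht p
  exact O.mul_mem _ _ (pow_mem hinv 2) (sub_mem (O.mul_mem _ _ (hp s) (O.mul_mem _ _ (hp _) hDt))
    (O.mul_mem _ _ (hp r) (O.mul_mem _ _ (hp _) hDt)))

theorem IntermediateField.adjoin_simple_inv (t : L) : k⟮t⁻¹⟯ = k⟮t⟯ := by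
  refine le_antisymm ?_ ?_ <;> rw [adjoin_simple_le_iff]
  · exact inv_mem (mem_adjoin_simple_self k t)
  · simpa using inv_mem (mem_adjoin_simple_self k t⁻¹)

/-- `t² d/dt` is a regular vector field at infinity. -/
theorem Derivation.sq_smul_apply_mem (hk : ∀ a : k, algebraMap k L a ∈ O)
    (D : Derivation k L L) {t z : L} (ht : t⁻¹ ∈ O) (ht0 : t ≠ 0) (hDt : D t = 1) (hz : z ∈ k⟮t⟯)
    (hzO : z ∈ O) : (t ^ 2 • D) z ∈ O := by
  refine (t ^ 2 • D).apply_mem_of_mem_adjoin hk ht ?_ (adjoin_simple_inv (k := k) t ▸ hz) hzO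
  rw [Derivation.smul_apply, Derivation.leibniz_inv, hDt]
  have : t ^ 2 • -t⁻¹ ^ 2 • (1 : L) = -1 := by
    simp only [smul_eq_mul]
    field_simp
  rw [this]
  exact neg_mem O.one_mem

theorem Derivation.apply_mem_of_eq_one (hk : ∀ a : k, algebraMap k L a ∈ O)
    (D : Derivation k L L) {t z : L} (hDt : D t = 1) (hz : z ∈ k⟮t⟯)
    (hzO : z ∈ O) : D z ∈ O := by
  by_cases ht : t ∈ O
  · exact D.apply_mem_of_mem_adjoin hk ht (by rw [hDt]; exact O.one_mem) hz hzO
  have ht0 : t ≠ 0 := fun h => ht (h ▸ O.zero_mem)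
  have hi := ValuationSubring.inv_mem_of_not_mem ht
  have := O.mul_mem _ _ (pow_mem hi 2) (D.sq_smul_apply_mem hk hi ht0 hDt hz hzO)
  rwa [Derivation.smul_apply, smul_eq_mul, ← mul_assoc, ← mul_pow, inv_mul_cancel₀ ht0, one_pow,
    one_mul] at this

/-- Over a subfield on which `D` is regular, with `η² ∈ K₀`, the derivation `η D` is regular on
`K₀(η)`. -/
theorem Derivation.mul_apply_mem_of_quadratic [NeZero (2 : L)] (D : Derivation k L L)
    (K₀ : IntermediateField k L) (h2 : (2 : L)⁻¹ ∈ O) (hD : ∀ w ∈ K₀, w ∈ O → D w ∈ O)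
    {η a b : L} (hη : η ^ 2 ∈ K₀) (hηO : η ∈ O) (ha : a ∈ K₀) (hb : b ∈ K₀)
    (hz : a + b * η ∈ O) : η * D (a + b * η) ∈ O := by
  have two : (2 : L) ≠ 0 := NeZero.ne 2
  have h2K : (2 : L) ∈ K₀ := by simp
  by_cases hz' : a - b * η ∈ O
  · have haO : a ∈ O := by
      have : a = 2⁻¹ * ((a + b * η) + (a - b * η)) := by field_simp; ring
      exact this ▸ O.mul_mem _ _ h2 (O.add_mem _ _ hz hz')
    have hbO : b * η ∈ O := by simpa using sub_mem hz haO
    rw [map_add, mul_add]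
    refine O.add_mem _ _ (O.mul_mem _ _ hηO (hD _ ha haO)) ?_
    refine D.mul_apply_mem_of_sq_mem h2 (hD _ ?_ (pow_mem hbO 2)) (hD _ hη (pow_mem hηO 2)) hηO
      fun e hη0 he heO => ?_
    · rw [mul_pow]; exact mul_mem (pow_mem hb 2) hη
    · exact hD _ (mul_right_cancel₀ hη0 he ▸ hb) heO
  · have hS : a + b * η + (a - b * η) = 2 * a := by ring
    have hSi : (a + b * η + (a - b * η))⁻¹ ∈ K₀ := by
      rw [hS]; exact inv_mem (mul_mem h2K ha)
    refine O.mul_mem _ _ hηO (D.apply_mem_of_conj_not_mem hz hz' (hD _ hSi) (hD _ (mul_mem ?_ hSi)))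
    rw [show (a + b * η) * (a - b * η) = a ^ 2 - b ^ 2 * η ^ 2 by ring]
    exact sub_mem (pow_mem ha 2) (mul_mem (pow_mem hb 2) hη)

end Rational

section PlaneCurve

variable {k L : Type} [Field k] [Field L] [Algebra k L] {d : ℕ} {F : MvPolynomial (Fin 3) k}

theorem IsSmoothPlaneCurve.exists_X_pow_mem (hF : IsSmoothPlaneCurve d F) (i : Fin 3) :
    ∃ n, X i ^ n ∈ Ideal.span (Set.range fun j => pderiv j F) := by
  have h : X i ∈ vanishingIdeal k (zeroLocus (AlgebraicClosure k)
      (Ideal.span (Set.range fun j => pderiv j F))) := by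
    rw [mem_vanishingIdeal_iff]
    intro P hP
    by_contra hne
    obtain ⟨j, hj⟩ := hF.2 P (fun h0 => hne (by simp [h0]))
    refine hj ?_
    rw [eval_map, ← aeval_def]
    exact hP _ (Ideal.subset_span ⟨j, rfl⟩)
  rwa [vanishingIdeal_zeroLocus_eq_radical] at h

theorem IsSmoothPlaneCurve.exists_aeval_ne_zero (hF : IsSmoothPlaneCurve d F) {Q : Fin 3 → L}
    (hQ : Q ≠ 0) : ∃ j, aeval Q (pderiv j F) ≠ 0 := by
  by_contra! h
  refine hQ (funext fun i => ?_)
  obtain ⟨n, hn⟩ := hF.exists_X_pow_mem i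
  have hle : Ideal.span (Set.range fun j => pderiv j F) ≤ RingHom.ker (aeval Q) := by
    rw [Ideal.span_le]
    rintro _ ⟨j, rfl⟩
    exact h j
  have := hle hn
  rw [RingHom.mem_ker, map_pow, aeval_X] at this
  exact eq_zero_of_pow_eq_zero this

theorem ValuationSubring.mvAeval_mem {O : ValuationSubring L}
    (hk : ∀ a : k, algebraMap k L a ∈ O) {Q : Fin 3 → L} (hQ : ∀ i, Q i ∈ O)
    (p : MvPolynomial (Fin 3) k) : aeval Q p ∈ O := by
  induction p using MvPolynomial.induction_on with
  | C a => simpa using hk a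
  | add p q hp hq => rw [map_add]; exact O.add_mem _ _ hp hq
  | mul_X p i hp => rw [map_mul, aeval_X]; exact O.mul_mem _ _ hp (hQ i)

theorem IsSmoothPlaneCurve.exists_valuation_eq_one (hF : IsSmoothPlaneCurve d F)
    {O : ValuationSubring L} (hk : ∀ a : k, algebraMap k L a ∈ O) {Q : Fin 3 → L}
    (hQ : ∀ i, Q i ∈ O) (hFQ : aeval Q F = 0) {i : Fin 3} (hi : Q i = 1) :
    ∃ j, j ≠ i ∧ O.valuation (aeval Q (pderiv j F)) = 1 := by
  by_contra! h
  have hlt : ∀ j, j ≠ i → O.valuation (aeval Q (pderiv j F)) < 1 := fun j hj =>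
    lt_of_le_of_ne ((O.valuation_le_one_iff _).2 (O.mvAeval_mem hk hQ _)) (h j hj)
  have hlti : O.valuation (aeval Q (pderiv i F)) < 1 := by
    have he := congrArg (aeval Q) hF.1.sum_X_mul_pderiv
    rw [map_nsmul, hFQ, smul_zero, map_sum, ← Finset.add_sum_erase _ _ (Finset.mem_univ i),
      map_mul, aeval_X, hi, one_mul] at he
    rw [eq_neg_of_add_eq_zero_left he, Valuation.map_neg]
    refine Valuation.map_sum_lt _ one_ne_zero fun j hj => ?_
    rw [map_mul, map_mul, aeval_X]
    exact mul_lt_one_of_nonneg_of_lt_one_right ((O.valuation_le_one_iff _).2 (hQ j)) zero_le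
      (hlt j (Finset.ne_of_mem_erase hj))
  have hall : ∀ j, O.valuation (aeval Q (pderiv j F)) < 1 := fun j => by
    by_cases hj : j = i
    · exact hj ▸ hlti
    · exact hlt j hj
  obtain ⟨n, hn⟩ := hF.exists_X_pow_mem i
  have key : ∀ p ∈ Ideal.span (Set.range fun j => pderiv j F), O.valuation (aeval Q p) < 1 := by
    intro p hp
    induction hp using Submodule.span_induction with
    | mem x hx => obtain ⟨j, rfl⟩ := hx; exact hall j
    | zero => simp
    | add x y _ _ hx hy => rw [map_add]; exact Valuation.map_add_lt _ hx hy
    | smul a x _ hx =>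
      rw [smul_eq_mul, map_mul, map_mul]
      exact mul_lt_one_of_nonneg_of_lt_one_right
        ((O.valuation_le_one_iff _).2 (O.mvAeval_mem hk hQ a)) zero_le hx
  have := key _ hn
  simp [hi] at this

theorem aeval_smul_of_isHomogeneous {n : ℕ} {p : MvPolynomial (Fin 3) k}
    (hp : p.IsHomogeneous n) (c : L) (Q : Fin 3 → L) :
    aeval (c • Q) p = c ^ n * aeval Q p := by
  rw [aeval_def, aeval_def, eval₂_eq', eval₂_eq', Finset.mul_sum]
  refine Finset.sum_congr rfl fun m hm => ?_
  have hd : ∑ i, m i = n := by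
    have := hp (mem_support_iff.1 hm)
    rwa [Finsupp.weight_apply, Finsupp.sum_fintype _ _ (by simp), Finset.sum_congr rfl
      (fun i _ => by simp : ∀ i ∈ Finset.univ, m i • (1 : Fin 3 → ℕ) i = m i)] at this
  simp only [Pi.smul_apply, smul_eq_mul, mul_pow, Finset.prod_mul_distrib,
    Finset.prod_pow_eq_pow_sum, hd]
  ring

/-- `δ` is the vector field on the curve `F = 0` given in homogeneous coordinates `P` by
`P × δP = ∇F(P)`. -/
def IsCurveDerivation (F : MvPolynomial (Fin 3) k) (P : Fin 3 → L) (δ : Derivation k L L) :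
    Prop :=
  P 2 = 1 ∧ aeval P F = 0 ∧ ∀ i j l : Fin 3, j = i + 1 → l = i + 2 →
    P i * δ (P j) - P j * δ (P i) = aeval P (pderiv l F)

/-- The differential dual to `δ`, multiplied by a quadratic monomial, is regular at every place. -/
theorem IsCurveDerivation.exists_mul_apply_eq (hd : 5 ≤ d) (hF : IsSmoothPlaneCurve d F)
    {P : Fin 3 → L} {δ : Derivation k L L} (h : IsCurveDerivation F P δ)
    {O : ValuationSubring L} (hk : ∀ a : k, algebraMap k L a ∈ O) (a b : Fin 3) :
    ∃ α ∈ O, ∃ β ∈ O, P a * P b = α * δ β := by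
  obtain ⟨h2, hFP, hx⟩ := h
  obtain ⟨i, hi⟩ := Finite.exists_max fun j => O.valuation (P j)
  have hi0 : P i ≠ 0 := fun h0 => by
    have := hi 2
    simp [h0, h2] at this
  have hQO : ∀ j, P j / P i ∈ O := fun j => by
    rw [← O.valuation_le_one_iff, map_div₀]
    exact div_le_one_of_le₀ (hi j) zero_le
  obtain ⟨Q, hQ⟩ : ∃ Q : Fin 3 → L, Q = fun j => P j / P i := ⟨_, rfl⟩
  have hPQ : P = P i • Q := by
    funext j
    rw [Pi.smul_apply, hQ, smul_eq_mul, mul_div_cancel₀ _ hi0]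
  have hFQ : aeval Q F = 0 := by
    rw [hPQ, aeval_smul_of_isHomogeneous hF.1] at hFP
    exact (mul_eq_zero.1 hFP).resolve_left (pow_ne_zero _ hi0)
  obtain ⟨l, hl, hv⟩ := hF.exists_valuation_eq_one hk (hQ ▸ hQO) hFQ
    (by rw [hQ]; exact div_self hi0 : Q i = 1)
  obtain ⟨j, ε, hε, hj⟩ : ∃ j : Fin 3, ∃ ε : L, ε ^ 2 = 1 ∧
      P i * δ (P j) - P j * δ (P i) = ε * aeval P (pderiv l F) := by
    have hcases : ∀ i l : Fin 3, l ≠ i → l = i + 2 ∨ l = i + 1 := by decide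
    have h3 : ∀ i : Fin 3, i = i + 2 + 1 ∧ i + 1 = i + 2 + 2 := by decide
    rcases hcases i l hl with rfl | rfl
    · exact ⟨i + 1, 1, by ring, by rw [hx i (i + 1) (i + 2) rfl rfl, one_mul]⟩
    · refine ⟨i + 2, -1, by ring, ?_⟩
      have := hx (i + 2) i (i + 1) (h3 i).1 (h3 i).2
      linear_combination -this
  have hδ : δ (P j / P i) = ε * P i ^ (d - 3) * aeval Q (pderiv l F) := by
    rw [Derivation.leibniz_div]
    simp only [smul_eq_mul]
    rw [hj]
    conv_lhs => rw [hPQ, aeval_smul_of_isHomogeneous hF.1.pderiv]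
    obtain ⟨e, rfl⟩ : ∃ e, d = e + 3 := ⟨d - 3, by omega⟩
    simp only [Nat.add_sub_cancel, show e + 3 - 1 = e + 2 by omega, Pi.smul_apply, hQ,
      smul_eq_mul, div_self hi0, mul_one]
    field_simp
    ring
  have hu0 : aeval Q (pderiv l F) ≠ 0 := fun h0 => by simp [h0] at hv
  have huO : (aeval Q (pderiv l F))⁻¹ ∈ O := by
    rw [← O.valuation_le_one_iff, map_inv₀, hv, inv_one]
  have hεO : ε ∈ O := by
    rcases sq_eq_one_iff.1 hε with h | h
    · exact h ▸ O.one_mem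
    · exact h ▸ neg_mem O.one_mem
  have hinv : (P i)⁻¹ ∈ O := by
    have := hQO 2
    rwa [h2, one_div] at this
  refine ⟨ε * (aeval Q (pderiv l F))⁻¹ * (P i)⁻¹ ^ (d - 5) * (P a / P i) * (P b / P i),
    ?_, P j / P i, hQO j, ?_⟩
  · exact O.mul_mem _ _ (O.mul_mem _ _ (O.mul_mem _ _ (O.mul_mem _ _ hεO huO) (pow_mem hinv _))
      (hQO a)) (hQO b)
  · rw [hδ]
    obtain ⟨e, rfl⟩ : ∃ e, d = e + 5 := ⟨d - 5, by omega⟩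
    simp only [Nat.add_sub_cancel, show e + 5 - 3 = e + 2 by omega]
    rw [inv_pow]
    field_simp
    rw [hε, mul_one]
    ring

/-- A double cover of a curve carrying the regular vector field `c • δ` cannot be a smooth plane
curve of degree at least five: the trace form on quadratic monomials is constant, and its kernel
is a line containing the generic point. -/
theorem IsCurveDerivation.false_of_involution [NeZero (2 : L)] (hd : 5 ≤ d)
    (hF : IsSmoothPlaneCurve d F) {P : Fin 3 → L} {δ : Derivation k L L}
    (h : IsCurveDerivation F P δ) (hline : ∀ ℓ : Fin 3 → k, ∑ i, algebraMap k L (ℓ i) * P i = 0 → ℓ = 0)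
    (σ : L ≃ₐ[k] L) (hσ : ∀ z, σ (σ z) = z) (hσP : ∃ i, σ (P i) ≠ P i) {c : L} (hc : c ≠ 0)
    (hcomm : ∀ z, σ ((c • δ) z) = (c • δ) (σ z))
    (hreg : ∀ O : ValuationSubring L, (∀ a : k, algebraMap k L a ∈ O) →
      ∀ w ∈ O, σ w = w → (c • δ) w ∈ O)
    (hconst : ∀ w, σ w = w → IsIntegral k w → ∃ a : k, algebraMap k L a = w) : False := by
  have hM : ∀ i j, ∃ m : k, algebraMap k L m = c * (P i * P j) + σ (c * (P i * P j)) := by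
    intro i j
    have hinv : σ (c * (P i * P j) + σ (c * (P i * P j))) = c * (P i * P j) + σ (c * (P i * P j)) := by
      rw [map_add, hσ, add_comm]
    refine hconst _ hinv (isIntegral_of_forall_mem_valuationSubring fun O hk => ?_)
    obtain ⟨α, hα, β, hβ, hαβ⟩ := h.exists_mul_apply_eq hd hF hk i j
    obtain ⟨α', hα', β', hβ', hαβ'⟩ := h.exists_mul_apply_eq hd hF
      (O := O.comap (σ : L →+* L)) (fun a => by
        rw [ValuationSubring.mem_comap]; simpa using hk a) i j
    have h2 : (2 : L)⁻¹ ∈ O := by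
      have := hk 2⁻¹
      rwa [map_inv₀, map_ofNat] at this
    have e1 : α * (c • δ) β = c * (P i * P j) := by
      rw [hαβ, Derivation.smul_apply, smul_eq_mul]; ring
    have e2 : σ α' * (c • δ) (σ β') = σ (c * (P i * P j)) := by
      rw [← hcomm, ← map_mul, hαβ', Derivation.smul_apply, smul_eq_mul]; ring_nf
    refine (c • δ).mem_of_fixed σ hσ hcomm h2 (hreg O hk) (a := α) (b := β) (a' := σ α')
      (b' := σ β') hα hβ hα' hβ' ?_ hinv
    rw [e1, e2]
  choose m hm using hM
  have hdet : (Matrix.of m).det = 0 := by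
    refine (algebraMap k L).injective ?_
    rw [map_zero, RingHom.map_det, Matrix.det_fin_three]
    simp only [RingHom.mapMatrix_apply, Matrix.map_apply, Matrix.of_apply, hm, map_mul]
    ring
  obtain ⟨ℓ, hℓ0, hℓ⟩ := Matrix.exists_mulVec_eq_zero_iff.2 hdet
  refine hℓ0 (hline ℓ ?_)
  obtain ⟨A, hA⟩ : ∃ A, A = ∑ i, algebraMap k L (ℓ i) * P i := ⟨_, rfl⟩
  have hσA : σ A = ∑ i, algebraMap k L (ℓ i) * σ (P i) := by
    rw [hA, map_sum]
    simp
  have hrow : ∀ i, c * P i * A + σ c * σ (P i) * σ A = 0 := by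
    intro i
    have := congrArg (algebraMap k L) (congrFun hℓ i)
    rw [Matrix.mulVec, dotProduct, map_sum, Pi.zero_apply, map_zero] at this
    rw [hσA, hA, Finset.mul_sum, Finset.mul_sum, ← Finset.sum_add_distrib, ← this]
    refine Finset.sum_congr rfl fun j _ => ?_
    rw [map_mul, Matrix.of_apply, hm]
    simp only [map_mul]
    ring
  rw [← hA]
  obtain ⟨i, hi⟩ := hσP
  have h2 := hrow 2
  rw [h.1, map_one] at h2
  have : c * (P i - σ (P i)) * A = 0 := by linear_combination hrow i - σ (P i) * h2
  exact (mul_eq_zero.1 this).resolve_left (mul_ne_zero hc (sub_ne_zero.2 (Ne.symm hi)))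

end PlaneCurve

section FunctionField

variable {k L : Type} [Field k] [Field L] [Algebra k L] {d : ℕ} {F : MvPolynomial (Fin 3) k}

/-- A homomorphism from a domain to the dual numbers over its fraction field, lifting the canonical
inclusion, comes from a derivation. -/
theorem exists_derivation_of_trivSqZeroExt {A : Type} [CommRing A] [IsDomain A] [Algebra k A]
    [Algebra A L] [IsFractionRing A L] [IsScalarTower k A L] (Φ : A →ₐ[k] TrivSqZeroExt L L)
    (hΦ : ∀ a, (Φ a).fst = algebraMap A L a) :
    ∃ δ : Derivation k L L, ∀ a, δ (algebraMap A L a) = (Φ a).snd := by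
  have hu : ∀ y : nonZeroDivisors A, IsUnit (Φ y) := fun y => by
    rw [TrivSqZeroExt.isUnit_iff_isUnit_fst, hΦ]
    exact IsLocalization.map_units L y
  have happ : ∀ a, IsLocalization.liftAlgHom (S := L) hu (algebraMap A L a) = Φ a := fun a => by
    rw [IsLocalization.liftAlgHom_apply]
    exact IsLocalization.lift_eq hu a
  generalize IsLocalization.liftAlgHom (S := L) hu = Ψ at happ
  have hfst : ∀ z, (Ψ z).fst = z := fun z => by
    have : (TrivSqZeroExt.fstHom k L L).comp Ψ = AlgHom.id k L := by
      refine IsLocalization.algHom_ext (nonZeroDivisors A) ?_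
      ext a
      exact (congrArg TrivSqZeroExt.fst (happ a)).trans (hΦ a)
    exact DFunLike.congr_fun this z
  refine ⟨Derivation.mk' ((TrivSqZeroExt.sndHom L L).restrictScalars k ∘ₗ Ψ.toLinearMap) ?_, ?_⟩
  · intro a b
    simp [hfst, TrivSqZeroExt.snd_mul, mul_comm]
  · intro a
    simp [happ]

theorem aeval_inl_add_inr {n : ℕ} (P u : Fin n → L) (p : MvPolynomial (Fin n) k) :
    aeval (fun i => (TrivSqZeroExt.inl (P i) + TrivSqZeroExt.inr (u i) : TrivSqZeroExt L L)) p =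
      TrivSqZeroExt.inl (aeval P p) + TrivSqZeroExt.inr (∑ i, u i * aeval P (pderiv i p)) := by
  induction p using MvPolynomial.induction_on with
  | C a => simp [TrivSqZeroExt.algebraMap_eq_inl']
  | add p q hp hq =>
    rw [map_add, hp, hq]
    simp only [map_add, mul_add, Finset.sum_add_distrib, TrivSqZeroExt.inl_add,
      TrivSqZeroExt.inr_add]
    abel
  | mul_X p i hp =>
    rw [map_mul, hp, aeval_X]
    ext
    · simp
    · simp only [TrivSqZeroExt.snd_mul, TrivSqZeroExt.fst_add, TrivSqZeroExt.fst_inl,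
        TrivSqZeroExt.fst_inr, TrivSqZeroExt.snd_add, TrivSqZeroExt.snd_inl,
        TrivSqZeroExt.snd_inr, zero_add, add_zero, Derivation.leibniz, pderiv_X, map_add,
        smul_eq_mul, map_mul, aeval_X, mul_add, Finset.sum_add_distrib, MulOpposite.smul_eq_mul_unop,
        MulOpposite.unop_op, Finset.sum_mul, Pi.single_apply, apply_ite (aeval P), 
        map_zero, mul_ite, mul_one, mul_zero, Finset.sum_ite_eq, Finset.mem_univ, if_true]
      rw [add_comm, mul_comm (u i)]
      congr 1
      exact Finset.sum_congr rfl fun j _ => by ring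

theorem sum_mul_aeval_pderiv_eq_zero (hF : F.IsHomogeneous d) {P : Fin 3 → L}
    (hP : aeval P F = 0) : ∑ i, P i * aeval P (pderiv i F) = 0 := by
  have he := congrArg (aeval P) hF.sum_X_mul_pderiv
  rw [map_nsmul, hP, smul_zero, map_sum] at he
  simpa using he

/-- The generic point of the plane curve `F = 0`, in homogeneous coordinates. -/
def curvePoint (F : MvPolynomial (Fin 3) k) [IsDomain (PlaneCurveRing k F)] :
    Fin 3 → FractionRing (PlaneCurveRing k F) :=
  ![algebraMap (PlaneCurveRing k F) _ (Ideal.Quotient.mk _ (X 0)),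
    algebraMap (PlaneCurveRing k F) _ (Ideal.Quotient.mk _ (X 1)), 1]

variable [IsDomain (PlaneCurveRing k F)]

theorem aeval_curvePoint (p : MvPolynomial (Fin 3) k) :
    aeval (curvePoint F) p = algebraMap (PlaneCurveRing k F) (FractionRing (PlaneCurveRing k F))
      (Ideal.Quotient.mk _ (aeval ![X 0, X 1, 1] p)) := by
  let Ψ : MvPolynomial (Fin 3) k →ₐ[k] FractionRing (PlaneCurveRing k F) :=
    ((Algebra.algHom k (PlaneCurveRing k F) (FractionRing (PlaneCurveRing k F))).comp
      (Ideal.Quotient.mkₐ k _)).comp (aeval ![X 0, X 1, 1])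
  have : aeval (curvePoint F) = Ψ := by
    refine MvPolynomial.algHom_ext fun i => ?_
    rw [aeval_X]
    simp only [Ψ, AlgHom.comp_apply, aeval_X]
    fin_cases i
    · rfl
    · rfl
    · exact (map_one (((Algebra.algHom k (PlaneCurveRing k F)
        (FractionRing (PlaneCurveRing k F))).comp (Ideal.Quotient.mkₐ k _)))).symm
  rw [this]
  rfl

theorem aeval_curvePoint_self : aeval (curvePoint F) F = 0 := by
  rw [aeval_curvePoint, Ideal.Quotient.eq_zero_iff_mem.2 (Ideal.mem_span_singleton_self _),
    map_zero]

theorem exists_isCurveDerivation (hF : F.IsHomogeneous d) :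
    ∃ δ : Derivation k (FractionRing (PlaneCurveRing k F)) (FractionRing (PlaneCurveRing k F)),
      IsCurveDerivation F (curvePoint F) δ := by
  set P := curvePoint F with hP
  have hPF : aeval P F = 0 := aeval_curvePoint_self
  have hP2 : P 2 = 1 := rfl
  let u : Fin 3 → FractionRing (PlaneCurveRing k F) :=
    ![aeval P (pderiv 1 F), -aeval P (pderiv 0 F), 0]
  let e : Fin 3 → TrivSqZeroExt (FractionRing (PlaneCurveRing k F))
    (FractionRing (PlaneCurveRing k F)) :=
    fun i => TrivSqZeroExt.inl (P i) + TrivSqZeroExt.inr (u i)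
  let Φ₀ : MvPolynomial (Fin 2) k →ₐ[k] TrivSqZeroExt (FractionRing (PlaneCurveRing k F))
    (FractionRing (PlaneCurveRing k F)) := aeval fun i => e i.castSucc
  have hcomp : ∀ p, Φ₀ (aeval ![X 0, X 1, 1] p) = aeval e p := fun p => by
    have : Φ₀.comp (aeval ![X 0, X 1, 1]) = aeval e := by
      refine MvPolynomial.algHom_ext fun i => ?_
      rw [AlgHom.comp_apply, aeval_X, aeval_X]
      fin_cases i
      · simp [Φ₀]
      · simp [Φ₀]
      · simp [e, hP2, u]
    exact DFunLike.congr_fun this p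
  have hΦF : Φ₀ (aeval ![X 0, X 1, 1] F) = 0 := by
    rw [hcomp, aeval_inl_add_inr, hPF, Fin.sum_univ_three]
    simp [u]
    ring_nf
    simp
  let Φ : PlaneCurveRing k F →ₐ[k] TrivSqZeroExt (FractionRing (PlaneCurveRing k F))
    (FractionRing (PlaneCurveRing k F)) :=
    Ideal.Quotient.liftₐ _ Φ₀ fun a ha => by
      rw [Ideal.mem_span_singleton'] at ha
      obtain ⟨b, rfl⟩ := ha
      rw [map_mul, hΦF, mul_zero]
  have hΦ : ∀ p, Φ (Ideal.Quotient.mk _ p) = Φ₀ p := fun p => rfl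
  obtain ⟨δ, hδ⟩ := exists_derivation_of_trivSqZeroExt Φ (fun a => by
    obtain ⟨p, rfl⟩ := Ideal.Quotient.mk_surjective a
    have : (TrivSqZeroExt.fstHom k _ _).comp Φ₀ =
        (Algebra.algHom k (PlaneCurveRing k F) (FractionRing (PlaneCurveRing k F))).comp
          (Ideal.Quotient.mkₐ k _) := by
      refine MvPolynomial.algHom_ext fun i => ?_
      fin_cases i <;> simp [Φ₀, e] <;> rfl
    exact DFunLike.congr_fun this p)
  have hδi : ∀ i, δ (P i) = u i := by
    intro i
    fin_cases i
    · refine (hδ _).trans ?_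
      rw [hΦ]
      simp [Φ₀, e]
    · refine (hδ _).trans ?_
      rw [hΦ]
      simp [Φ₀, e]
    · simp [u, hP2]
  have hE : P 0 * aeval P (pderiv 0 F) + P 1 * aeval P (pderiv 1 F) + aeval P (pderiv 2 F) = 0 := by
    have he := sum_mul_aeval_pderiv_eq_zero hF hPF
    rwa [Fin.sum_univ_three, hP2, one_mul] at he
  refine ⟨δ, hP2, hPF, ?_⟩
  rintro i j l rfl rfl
  rw [hδi, hδi]
  fin_cases i
  · simp [u]
    linear_combination -hE
  · simp [u, hP2]
  · simp [u, hP2]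

end FunctionField

section GenericPoint

variable {k L : Type} [Field k] [Field L] [Algebra k L] {d : ℕ} {F : MvPolynomial (Fin 3) k}

theorem IsCurveDerivation.exists_apply_ne_zero (hF : IsSmoothPlaneCurve d F) {P : Fin 3 → L}
    {δ : Derivation k L L} (h : IsCurveDerivation F P δ) : ∃ z, δ z ≠ 0 := by
  by_contra! h0
  obtain ⟨l, hl⟩ := hF.exists_aeval_ne_zero (Q := P) fun hP => by
    simpa [hP] using h.1
  have h3 : ∀ l : Fin 3, l = l + 1 + 2 := by decide
  refine hl ?_
  rw [← h.2.2 (l + 1) (l + 1 + 1) l rfl (h3 l), h0, h0]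
  ring

theorem coeff_dehomogenize (hF : F.IsHomogeneous d) {m : Fin 3 →₀ ℕ} (hm : m ∈ F.support) :
    coeff (Finsupp.single 0 (m 0) + Finsupp.single 1 (m 1))
      (aeval ![X 0, X 1, 1] F : MvPolynomial (Fin 2) k) = coeff m F := by
  have hdeg : ∀ m ∈ F.support, m 0 + m 1 + m 2 = d := fun m hm => by
    have := hF (mem_support_iff.1 hm)
    rw [Finsupp.weight_apply, Finsupp.sum_fintype _ _ (by simp), Fin.sum_univ_three] at this
    simpa using this
  have hsum : (aeval ![X 0, X 1, 1] F : MvPolynomial (Fin 2) k) = ∑ n ∈ F.support,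
      monomial (Finsupp.single 0 (n 0) + Finsupp.single 1 (n 1)) (coeff n F) := by
    rw [aeval_def, eval₂_eq']
    refine Finset.sum_congr rfl fun n _ => ?_
    rw [Fin.prod_univ_three, monomial_eq, Finsupp.prod_fintype _ _ (by simp), Fin.prod_univ_two]
    simp [MvPolynomial.algebraMap_eq]
  rw [hsum, coeff_sum, Finset.sum_eq_single_of_mem m hm, coeff_monomial, if_pos rfl]
  intro n hn hne
  rw [coeff_monomial, if_neg]
  intro he
  have h0 := DFunLike.congr_fun he 0
  have h1 := DFunLike.congr_fun he 1
  simp at h0 h1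
  have hdm := hdeg m hm
  have hdn := hdeg n hn
  refine hne (Finsupp.ext fun i => ?_)
  fin_cases i
  · exact h0
  · exact h1
  · change n 2 = m 2
    omega

theorem IsSmoothPlaneCurve.one_lt_totalDegree_dehomogenize (hd : 5 ≤ d)
    (hF : IsSmoothPlaneCurve d F) :
    1 < (aeval ![X 0, X 1, 1] F : MvPolynomial (Fin 2) k).totalDegree := by
  by_contra! hle
  have hdvd : X 2 ^ 2 ∣ F := by
    rw [F.as_sum]
    refine Finset.dvd_sum fun m hm => ?_
    have hm' : Finsupp.single 0 (m 0) + Finsupp.single 1 (m 1) ∈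
        (aeval ![X 0, X 1, 1] F : MvPolynomial (Fin 2) k).support := by
      rw [mem_support_iff, coeff_dehomogenize hF.1 hm]
      exact mem_support_iff.1 hm
    have hle' := (le_totalDegree hm').trans hle
    rw [Finsupp.sum_fintype _ _ (by simp), Fin.sum_univ_two] at hle'
    simp at hle'
    have hdm := hF.1 (mem_support_iff.1 hm)
    rw [Finsupp.weight_apply, Finsupp.sum_fintype _ _ (by simp), Fin.sum_univ_three] at hdm
    simp at hdm
    rw [X_pow_eq_monomial, monomial_dvd_monomial]
    refine ⟨Or.inr ?_, one_dvd _⟩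
    rw [Finsupp.single_le_iff]
    omega
  obtain ⟨G, rfl⟩ := hdvd
  obtain ⟨j, hj⟩ := hF.exists_aeval_ne_zero (L := k) (Q := ![1, 0, 0]) fun h => by
    simpa using congrFun h 0
  refine hj ?_
  simp [Derivation.leibniz, Derivation.leibniz_pow]

variable [IsDomain (PlaneCurveRing k F)]

theorem eq_zero_of_sum_mul_curvePoint_eq_zero (hd : 5 ≤ d) (hF : IsSmoothPlaneCurve d F)
    {ℓ : Fin 3 → k} (hℓ : ∑ i, algebraMap k _ (ℓ i) * curvePoint F i = 0) : ℓ = 0 := by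
  obtain ⟨q, hq⟩ : ∃ q : MvPolynomial (Fin 2) k,
    q = C (ℓ 0) * X 0 + C (ℓ 1) * X 1 + C (ℓ 2) := ⟨_, rfl⟩
  have hqF : (aeval ![X 0, X 1, 1] F : MvPolynomial (Fin 2) k) ∣ q := by
    rw [← Ideal.mem_span_singleton, ← Ideal.Quotient.eq_zero_iff_mem]
    refine IsFractionRing.injective (PlaneCurveRing k F) (FractionRing (PlaneCurveRing k F)) ?_
    rw [map_zero, ← hℓ]
    have := aeval_curvePoint (F := F) (∑ i, C (ℓ i) * X i)
    simp only [map_sum, map_mul, aeval_X, aeval_C] at this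
    rw [this, Fin.sum_univ_three, hq]
    simp only [Matrix.cons_val_zero, Matrix.cons_val_one, Matrix.cons_val, mul_one,
      MvPolynomial.algebraMap_eq, map_add, map_mul, map_one]
  have hq1 : q.totalDegree ≤ 1 := by
    rw [hq]
    refine (totalDegree_add _ _).trans (max_le ((totalDegree_add _ _).trans (max_le ?_ ?_)) ?_)
    · exact (totalDegree_mul _ _).trans (by simp)
    · exact (totalDegree_mul _ _).trans (by simp)
    · simp
  have hq0 : q = 0 := by
    by_contra hne
    obtain ⟨g, hg⟩ := hqF
    rw [hg, totalDegree_mul_of_isDomain (fun h => hne (by rw [hg, h, zero_mul]))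
      (fun h => hne (by rw [hg, h, mul_zero]))] at hq1
    have := hF.one_lt_totalDegree_dehomogenize hd
    omega
  have hev : ∀ v : Fin 2 → k, ℓ 0 * v 0 + ℓ 1 * v 1 + ℓ 2 = 0 := fun v => by
    simpa [hq0] using (congrArg (eval v) hq).symm
  have h00 := hev 0
  have h10 := hev ![1, 0]
  have h01 := hev ![0, 1]
  simp at h00 h10 h01
  rw [h00] at h10 h01
  funext i
  fin_cases i
  · simpa using h10
  · simpa using h01
  · exact h00

theorem apply_eq_of_apply_curvePoint_eq
    (σ : FractionRing (PlaneCurveRing k F) ≃ₐ[k] FractionRing (PlaneCurveRing k F))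
    (hσ : ∀ i, σ (curvePoint F i) = curvePoint F i) (z) : σ z = z := by
  obtain ⟨a, b, -, rfl⟩ := IsFractionRing.div_surjective (PlaneCurveRing k F) z
  have key : ∀ a : PlaneCurveRing k F, σ (algebraMap _ _ a) = algebraMap _ _ a := fun a => by
    obtain ⟨p, rfl⟩ := Ideal.Quotient.mk_surjective a
    let Ψ := (Algebra.algHom k (PlaneCurveRing k F) (FractionRing (PlaneCurveRing k F))).comp
      (Ideal.Quotient.mkₐ k _)
    have : (σ : FractionRing (PlaneCurveRing k F) →ₐ[k] _).comp Ψ = Ψ := by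
      refine MvPolynomial.algHom_ext fun i => ?_
      fin_cases i
      · exact hσ 0
      · exact hσ 1
    exact DFunLike.congr_fun this p
  rw [map_div₀, key, key]

end GenericPoint

section DoubleCover

open IntermediateField

variable {k L : Type} [Field k] [Field L] [Algebra k L]

theorem exists_involution_of_finrank_eq_two [CharZero k] (K : IntermediateField k L)
    (h : Module.finrank K L = 2) : ∃ σ : L ≃ₐ[k] L,
      (∀ z, σ (σ z) = z) ∧ (∃ z, σ z ≠ z) ∧ ∀ z, σ z = z ↔ z ∈ K := by
  have : CharZero K := charZero_of_injective_algebraMap (algebraMap k K).injective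
  have : Algebra.IsQuadraticExtension K L := { finrank_eq_two' := h }
  have : FiniteDimensional K L := Module.finite_of_finrank_eq_succ h
  have hcard : Nat.card Gal(L/K) = 2 := by rw [IsGalois.card_aut_eq_finrank, h]
  obtain ⟨τ, hτ, hu⟩ := (Nat.card_eq_two_iff' (1 : Gal(L/K))).1 hcard
  have hττ : ∀ z, τ (τ z) = z := fun z => by
    have : τ ^ 2 = 1 := hcard ▸ pow_card_eq_one'
    rw [sq] at this
    exact DFunLike.congr_fun this z
  have hfix : ∀ z, τ z = z ↔ z ∈ K := fun z => by
    have := IsGalois.mem_range_algebraMap_iff_fixed (F := K) z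
    rw [show z ∈ K ↔ z ∈ Set.range (algebraMap K L) by simp, this]
    refine ⟨fun hz f => ?_, fun hz => hz τ⟩
    by_cases hf : f = 1
    · rw [hf]; rfl
    · rw [hu f hf]; exact hz
  refine ⟨τ.restrictScalars k, hττ, ?_, hfix⟩
  by_contra! hall
  exact hτ (AlgEquiv.ext hall)

theorem Derivation.exists_conj_sub (D : Derivation k L L) (σ : L ≃ₐ[k] L)
    (hσ : ∀ z, σ (σ z) = z) : ∃ E : Derivation k L L, ∀ z, E z = σ (D (σ z)) - D z := by
  refine ⟨Derivation.mk' (σ.toLinearMap ∘ₗ (D : L →ₗ[k] L) ∘ₗ σ.toLinearMap - (D : L →ₗ[k] L)) ?_,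
    fun z => rfl⟩
  intro a b
  simp only [LinearMap.sub_apply, LinearMap.comp_apply, AlgEquiv.toLinearMap_apply,
    Derivation.coeFn_coe, map_mul, Derivation.leibniz, smul_eq_mul, map_add, hσ]
  ring

theorem exists_algebraMap_eq_of_isIntegral_of_mem_adjoin {t z : L} (ht : Transcendental k t)
    (hz : z ∈ k⟮t⟯) (hi : IsIntegral k z) : ∃ a : k, algebraMap k L a = z := by
  let e := RatFunc.algEquivOfTranscendental t ht
  obtain ⟨f, hf⟩ := e.surjective ⟨z, hz⟩
  have hfi : IsIntegral k f := by
    rw [← isIntegral_algEquiv e, hf]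
    exact (isIntegral_algebraMap_iff (algebraMap k⟮t⟯ L).injective).1 hi
  by_cases hc : ∃ c, f = RatFunc.C c
  · obtain ⟨c, rfl⟩ := hc
    refine ⟨c, ?_⟩
    have := congrArg Subtype.val hf
    rw [← RatFunc.algebraMap_eq_C, AlgEquiv.commutes] at this
    exact this
  · exact absurd hfi.isAlgebraic (RatFunc.transcendental_of_ne_C f hc)

/-- A polynomial of odd degree is not a constant times a square in the rational function field. -/
theorem eq_zero_of_sq_mul_aeval_eq {t a b : L} (ht : Transcendental k t) {q : Polynomial k}
    (hq : Odd q.natDegree) (ha : a ∈ k⟮t⟯) (hb : b ∈ k⟮t⟯) {c : k}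
    (h : b ^ 2 * Polynomial.aeval t q = algebraMap k L c * a ^ 2) : b = 0 := by
  let e := RatFunc.algEquivOfTranscendental t ht
  obtain ⟨f, hf⟩ := e.surjective ⟨a, ha⟩
  obtain ⟨g, hg⟩ := e.surjective ⟨b, hb⟩
  have hq0 : q ≠ 0 := fun h0 => by simp [h0] at hq
  by_contra hb0
  have hg0 : g ≠ 0 := fun h0 => hb0 (by
    have := congrArg Subtype.val hg
    rw [h0, map_zero] at this
    exact this.symm)
  have key : g ^ 2 * algebraMap (Polynomial k) (RatFunc k) q = RatFunc.C c * f ^ 2 := by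
    refine e.injective (Subtype.ext ?_)
    rw [map_mul, map_mul, map_pow, map_pow, hf, hg, ← RatFunc.algebraMap_eq_C, AlgEquiv.commutes]
    refine Eq.trans ?_ h
    have he : e (algebraMap (Polynomial k) (RatFunc k) q) = (Polynomial.aeval t q : L) := by
      rw [RatFunc.algEquivOfTranscendental_algebraMap]
      exact (Polynomial.aeval_algebraMap_apply L (AdjoinSimple.gen k t) q).symm
    rw [← he]
    rfl
  have hl : g ^ 2 * algebraMap (Polynomial k) (RatFunc k) q ≠ 0 :=
    mul_ne_zero (pow_ne_zero _ hg0) (RatFunc.algebraMap_ne_zero hq0)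
  have hr := key ▸ hl
  have hc0 := left_ne_zero_of_mul hr
  have hf0 : f ≠ 0 := fun h0 => hr (by simp [h0])
  have := congrArg RatFunc.intDegree key
  rw [RatFunc.intDegree_mul (pow_ne_zero _ hg0) (RatFunc.algebraMap_ne_zero hq0),
    RatFunc.intDegree_mul hc0 (pow_ne_zero _ hf0), sq, sq, RatFunc.intDegree_mul hg0 hg0,
    RatFunc.intDegree_mul hf0 hf0, RatFunc.intDegree_C, RatFunc.intDegree_polynomial] at this
  obtain ⟨n, hn⟩ := hq
  omega

variable {d : ℕ} {F : MvPolynomial (Fin 3) k}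

theorem IsCurveDerivation.not_isHyperellipticOver [CharZero k] (hd : 5 ≤ d)
    (hF : IsSmoothPlaneCurve d F) {P : Fin 3 → L} {δ : Derivation k L L}
    (h : IsCurveDerivation F P δ)
    (hline : ∀ ℓ : Fin 3 → k, ∑ i, algebraMap k L (ℓ i) * P i = 0 → ℓ = 0)
    (hgen : ∀ σ : L ≃ₐ[k] L, (∀ i, σ (P i) = P i) → ∀ z, σ z = z) :
    ¬ IsHyperellipticOver k L := by
  rintro ⟨t, ht, hfr⟩
  have : CharZero L := charZero_of_injective_algebraMap (algebraMap k L).injective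
  obtain ⟨σ, hσ, ⟨z₀, hz₀⟩, hfix⟩ := exists_involution_of_finrank_eq_two _ hfr
  have hzero : ∀ E : Derivation k L L, E t = 0 → ∀ z, E z = 0 := fun E hE =>
    E.eq_zero_of_fixed σ hσ fun w hw => E.eq_zero_of_mem_adjoin hE ((hfix w).1 hw)
  have hδt : δ t ≠ 0 := fun h0 => by
    obtain ⟨z, hz⟩ := h.exists_apply_ne_zero hF
    exact hz (hzero δ h0 z)
  have hDt : ((δ t)⁻¹ • δ) t = 1 := by
    rw [Derivation.smul_apply, smul_eq_mul, inv_mul_cancel₀ hδt]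
  have hσt : σ t = t := (hfix t).2 (mem_adjoin_simple_self k t)
  refine h.false_of_involution hd hF hline σ hσ ?_ (inv_ne_zero hδt) ?_ ?_ ?_
  · by_contra! hall
    exact hz₀ (hgen σ hall z₀)
  · intro z
    obtain ⟨E, hE⟩ := ((δ t)⁻¹ • δ).exists_conj_sub σ hσ
    have := hzero E (by rw [hE, hσt, hDt, map_one, sub_self]) (σ z)
    rw [hE, hσ] at this
    exact sub_eq_zero.1 this
  · exact fun O hk w hw hσw => Derivation.apply_mem_of_eq_one hk _ hDt ((hfix w).1 hσw) hw
  · exact fun w hσw hi =>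
      exists_algebraMap_eq_of_isIntegral_of_mem_adjoin ht ((hfix w).1 hσw) hi

end DoubleCover

section Bielliptic

open IntermediateField

variable {k L : Type} [Field k] [Field L] [Algebra k L]

theorem aeval_mem_adjoin_simple (t : L) (p : Polynomial k) : Polynomial.aeval t p ∈ k⟮t⟯ := by
  rw [Polynomial.aeval_eq_sum_range]
  exact sum_mem fun i _ => IntermediateField.smul_mem _ (pow_mem (mem_adjoin_simple_self k t) i)

theorem WeierstrassCurve.odd_natDegree_twoTorsionPolynomial [CharZero k] (W : WeierstrassCurve k) :
    Odd W.twoTorsionPolynomial.toPoly.natDegree := by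
  rw [Cubic.natDegree_of_a_ne_zero (by simp [WeierstrassCurve.twoTorsionPolynomial])]
  decide

theorem WeierstrassCurve.aeval_twoTorsionPolynomial (W : WeierstrassCurve k) (t : L) :
    Polynomial.aeval t W.twoTorsionPolynomial.toPoly = 4 * t ^ 3 + algebraMap k L W.b₂ * t ^ 2 +
      2 * algebraMap k L W.b₄ * t + algebraMap k L W.b₆ := by
  simp [WeierstrassCurve.twoTorsionPolynomial, Cubic.toPoly, map_ofNat (algebraMap k L)]

theorem add_mul_div_mem_quadratic {t η : L} (ht : Transcendental k t) {q : Polynomial k}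
    (hq : Odd q.natDegree) (hη : η ^ 2 = Polynomial.aeval t q) {a b c e : L} (ha : a ∈ k⟮t⟯)
    (hb : b ∈ k⟮t⟯) (hc : c ∈ k⟮t⟯) (he : e ∈ k⟮t⟯) :
    ∃ a' ∈ k⟮t⟯, ∃ b' ∈ k⟮t⟯, (a + b * η) / (c + e * η) = a' + b' * η := by
  have hqK : Polynomial.aeval t q ∈ k⟮t⟯ := aeval_mem_adjoin_simple t q
  by_cases h0 : c + e * η = 0
  · exact ⟨0, zero_mem _, 0, zero_mem _, by simp [h0]⟩
  have hn : c ^ 2 - e ^ 2 * Polynomial.aeval t q ≠ 0 := fun hn => by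
    have he0 : e = 0 := eq_zero_of_sq_mul_aeval_eq ht hq hc he (c := 1) (by
      rw [map_one]; linear_combination -hn)
    rw [he0] at hn h0
    refine h0 ?_
    have : c ^ 2 = 0 := by linear_combination hn
    simp [eq_zero_of_pow_eq_zero this]
  have hnK := sub_mem (pow_mem hc 2) (mul_mem (pow_mem he 2) hqK)
  refine ⟨(a * c - b * e * Polynomial.aeval t q) / (c ^ 2 - e ^ 2 * Polynomial.aeval t q),
    div_mem (sub_mem (mul_mem ha hc) (mul_mem (mul_mem hb he) hqK)) hnK,
    (b * c - a * e) / (c ^ 2 - e ^ 2 * Polynomial.aeval t q),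
    div_mem (sub_mem (mul_mem hb hc) (mul_mem ha he)) hnK, ?_⟩
  rw [div_mul_eq_mul_div, ← add_div, div_eq_div_iff h0 hn, ← hη]
  ring

theorem WeierstrassCurve.exists_quadratic_of_algHom [CharZero k] (W : WeierstrassCurve k)
    (φ : W.toAffine.FunctionField →ₐ[k] L) : ∃ t η : L, Transcendental k t ∧
      η ^ 2 = Polynomial.aeval t W.twoTorsionPolynomial.toPoly ∧
      t ∈ φ.fieldRange ∧ η ∈ φ.fieldRange ∧
      ∀ z ∈ φ.fieldRange, ∃ a ∈ k⟮t⟯, ∃ b ∈ k⟮t⟯, z = a + b * η := by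
  have : CharZero L := charZero_of_injective_algebraMap (algebraMap k L).injective
  let g : W.toAffine.CoordinateRing →ₐ[k] L := φ.comp (Algebra.algHom k _ _)
  have hg : Function.Injective g :=
    φ.injective.comp (IsFractionRing.injective W.toAffine.CoordinateRing W.toAffine.FunctionField)
  let Ψ : Polynomial k →ₐ[k] L := g.comp (Algebra.algHom k (Polynomial k) _)
  obtain ⟨t, ht⟩ : ∃ t, t = Ψ Polynomial.X := ⟨_, rfl⟩
  obtain ⟨y, hy⟩ : ∃ y, y = g (WeierstrassCurve.Affine.CoordinateRing.mk W.toAffine Polynomial.X) :=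
    ⟨_, rfl⟩
  have hΨ : ∀ p, Ψ p = Polynomial.aeval t p := fun p => by
    rw [ht, Polynomial.aeval_algHom_apply, Polynomial.aeval_X_left_apply]
  have hgb : ∀ p q : Polynomial k, g (p • (1 : W.toAffine.CoordinateRing) +
      q • WeierstrassCurve.Affine.CoordinateRing.mk W.toAffine Polynomial.X) =
        Polynomial.aeval t p + Polynomial.aeval t q * y := fun p q => by
    rw [map_add, WeierstrassCurve.Affine.CoordinateRing.smul,
      WeierstrassCurve.Affine.CoordinateRing.smul, mul_one, map_mul, ← hy, ← hΨ, ← hΨ]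
    rfl
  have htr : Transcendental k t := by
    rw [transcendental_iff]
    intro p hp
    have h0 := hgb p 0
    rw [hp, map_zero, zero_mul, add_zero, ← map_zero g] at h0
    exact (WeierstrassCurve.Affine.CoordinateRing.smul_basis_eq_zero (hg h0)).1
  have hy2 : y ^ 2 = t ^ 3 + algebraMap k L W.a₂ * t ^ 2 + algebraMap k L W.a₄ * t +
      algebraMap k L W.a₆ - (algebraMap k L W.a₁ * t + algebraMap k L W.a₃) * y := by
    have h := congrArg g (WeierstrassCurve.Affine.CoordinateRing.smul_basis_mul_Y
      (W' := W.toAffine) 0 1)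
    rw [map_mul, hgb, hgb, ← hy] at h
    simp at h
    linear_combination h
  have htK : t ∈ φ.fieldRange := ⟨_, ht.symm⟩
  have hyK : y ∈ φ.fieldRange := ⟨_, hy.symm⟩
  obtain ⟨η, hη⟩ : ∃ η, η = 2 * y + (algebraMap k L W.a₁ * t + algebraMap k L W.a₃) := ⟨_, rfl⟩
  have hη2 : η ^ 2 = Polynomial.aeval t W.twoTorsionPolynomial.toPoly := by
    rw [W.aeval_twoTorsionPolynomial, hη, WeierstrassCurve.b₂, WeierstrassCurve.b₄, WeierstrassCurve.b₆]
    simp only [map_add, map_mul, map_pow, map_ofNat]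
    linear_combination 4 * hy2
  refine ⟨t, η, htr, hη2, htK, ?_, ?_⟩
  · rw [hη]
    exact add_mem (mul_mem (by simp) hyK)
      (add_mem (mul_mem (IntermediateField.algebraMap_mem _ _) htK) (IntermediateField.algebraMap_mem _ _))
  have hrep : ∀ r, ∃ a ∈ k⟮t⟯, ∃ b ∈ k⟮t⟯, g r = a + b * η := fun r => by
    obtain ⟨p, q, rfl⟩ := WeierstrassCurve.Affine.CoordinateRing.exists_smul_basis_eq r
    have htt := mem_adjoin_simple_self k t
    have hm : ∀ p : Polynomial k, Polynomial.aeval t p ∈ k⟮t⟯ := aeval_mem_adjoin_simple t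
    refine ⟨Polynomial.aeval t p - Polynomial.aeval t q *
        (algebraMap k L W.a₁ * t + algebraMap k L W.a₃) / 2,
      sub_mem (hm p) (div_mem (mul_mem (hm q) (add_mem (mul_mem (IntermediateField.algebraMap_mem _ _) htt)
        (IntermediateField.algebraMap_mem _ _))) (by simp)), Polynomial.aeval t q / 2, div_mem (hm q) (by simp), ?_⟩
    rw [hgb, hη]
    ring
  rintro _ ⟨u, rfl⟩
  obtain ⟨r, s, -, rfl⟩ := IsFractionRing.div_surjective W.toAffine.CoordinateRing u
  obtain ⟨a, ha, b, hb, hr⟩ := hrep r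
  obtain ⟨c, hc, e, he, hs⟩ := hrep s
  have hφ : φ (algebraMap _ _ r / algebraMap _ _ s) = g r / g s := map_div₀ φ _ _
  change ∃ a ∈ k⟮t⟯, ∃ b ∈ k⟮t⟯, φ (_ / _) = a + b * η
  rw [hφ, hr, hs]
  exact add_mul_div_mem_quadratic htr W.odd_natDegree_twoTorsionPolynomial hη2 ha hb hc he

theorem exists_algebraMap_eq_of_isIntegral_quadratic [NeZero (2 : L)] {t η : L}
    (ht : Transcendental k t) {q : Polynomial k} (hq : Odd q.natDegree)
    (hη : η ^ 2 = Polynomial.aeval t q) {a b : L} (ha : a ∈ k⟮t⟯) (hb : b ∈ k⟮t⟯)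
    (hi : IsIntegral k (a + b * η)) : ∃ c : k, algebraMap k L c = a + b * η := by
  have hqK : Polynomial.aeval t q ∈ k⟮t⟯ := aeval_mem_adjoin_simple t q
  have two : (2 : L) ≠ 0 := NeZero.ne 2
  have hconj : ∀ p : Polynomial k, ∃ u ∈ k⟮t⟯, ∃ v ∈ k⟮t⟯,
      Polynomial.aeval (a + b * η) p = u + v * η ∧ Polynomial.aeval (a - b * η) p = u - v * η := by
    intro p
    induction p using Polynomial.induction_on with
    | C c => exact ⟨algebraMap k L c, IntermediateField.algebraMap_mem _ _, 0, zero_mem _, by simp, by simp⟩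
    | add p r hp hr =>
      obtain ⟨u, hu, v, hv, h1, h2⟩ := hp
      obtain ⟨u', hu', v', hv', h1', h2'⟩ := hr
      refine ⟨u + u', add_mem hu hu', v + v', add_mem hv hv', ?_, ?_⟩
      · rw [map_add, h1, h1']; ring
      · rw [map_add, h2, h2']; ring
    | monomial n c hp =>
      obtain ⟨u, hu, v, hv, h1, h2⟩ := hp
      refine ⟨u * a + v * b * Polynomial.aeval t q, add_mem (mul_mem hu ha)
        (mul_mem (mul_mem hv hb) hqK), u * b + v * a, add_mem (mul_mem hu hb) (mul_mem hv ha), ?_, ?_⟩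
      · rw [pow_succ, ← mul_assoc, map_mul, h1, Polynomial.aeval_X, ← hη]; ring
      · rw [pow_succ, ← mul_assoc, map_mul, h2, Polynomial.aeval_X, ← hη]; ring
  have hi' : IsIntegral k (a - b * η) := by
    obtain ⟨p, hp, hp0⟩ := hi
    obtain ⟨u, hu, v, hv, h1, h2⟩ := hconj p
    refine ⟨p, hp, ?_⟩
    rw [← Polynomial.aeval_def] at hp0 ⊢
    rw [hp0] at h1
    have hv0 : v = 0 := eq_zero_of_sq_mul_aeval_eq ht hq hu hv (c := 1) (by
      rw [map_one, ← hη]; linear_combination (u - v * η) * h1)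
    rw [hv0] at h1 h2
    rw [h2]
    linear_combination -h1
  have haI : IsIntegral k a := by
    have : a = algebraMap k L 2⁻¹ * ((a + b * η) + (a - b * η)) := by
      rw [map_inv₀, map_ofNat]; field_simp; ring
    rw [this]
    exact isIntegral_algebraMap.mul (hi.add hi')
  have hbI : IsIntegral k (b ^ 2 * Polynomial.aeval t q) := by
    have : b ^ 2 * Polynomial.aeval t q = (a + b * η - a) ^ 2 := by rw [← hη]; ring
    rw [this]
    exact (hi.sub haI).pow 2
  obtain ⟨c, hc⟩ := exists_algebraMap_eq_of_isIntegral_of_mem_adjoin ht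
    (mul_mem (pow_mem hb 2) hqK) hbI
  have hb0 : b = 0 := eq_zero_of_sq_mul_aeval_eq ht hq (one_mem _) hb (c := c) (by
    rw [hc, one_pow, mul_one])
  rw [hb0, zero_mul, add_zero]
  exact exists_algebraMap_eq_of_isIntegral_of_mem_adjoin ht ha haI

theorem ValuationSubring.mem_of_sq_mem {O : ValuationSubring L} {η : L} (h : η ^ 2 ∈ O) : η ∈ O := by
  by_contra hη
  have hη0 : η ≠ 0 := fun h0 => hη (h0 ▸ O.zero_mem)
  refine hη ?_
  have := O.mul_mem _ _ h (ValuationSubring.inv_mem_of_not_mem hη)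
  rwa [pow_two, mul_assoc, mul_inv_cancel₀ hη0, mul_one] at this

/-- With `η² = 4t³ + b₂t² + 2b₄t + b₆` and `D t = 1`, the derivation `η D` is dual to an invariant
differential, hence regular at every place. -/
theorem Derivation.mul_apply_mem_of_twoTorsionPolynomial [CharZero L] {O : ValuationSubring L}
    (hk : ∀ a : k, algebraMap k L a ∈ O) (W : WeierstrassCurve k) (D : Derivation k L L)
    {t η a b : L} (hDt : D t = 1)
    (hη : η ^ 2 = Polynomial.aeval t W.twoTorsionPolynomial.toPoly) (ha : a ∈ k⟮t⟯) (hb : b ∈ k⟮t⟯)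
    (hz : a + b * η ∈ O) : η * D (a + b * η) ∈ O := by
  have h2 : (2 : L)⁻¹ ∈ O := by
    have := hk 2⁻¹
    rwa [map_inv₀, map_ofNat] at this
  have htK := mem_adjoin_simple_self k t
  have hηK : η ^ 2 ∈ k⟮t⟯ := hη ▸ aeval_mem_adjoin_simple t _
  by_cases ht : t ∈ O
  · refine D.mul_apply_mem_of_quadratic k⟮t⟯ h2 (fun w hw hwO => D.apply_mem_of_eq_one hk hDt hw hwO)
      hηK (ValuationSubring.mem_of_sq_mem ?_) ha hb hz
    rw [hη]
    exact ValuationSubring.aeval_mem hk ht _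
  have ht0 : t ≠ 0 := fun h => ht (h ▸ O.zero_mem)
  have hi := ValuationSubring.inv_mem_of_not_mem ht
  have hη1 : (η / t ^ 2) ^ 2 = Polynomial.aeval t⁻¹ (Polynomial.C 4 * Polynomial.X +
      Polynomial.C W.b₂ * Polynomial.X ^ 2 + Polynomial.C (2 * W.b₄) * Polynomial.X ^ 3 +
      Polynomial.C W.b₆ * Polynomial.X ^ 4) := by
    rw [div_pow, hη, W.aeval_twoTorsionPolynomial]
    simp only [map_add, map_mul, map_pow, Polynomial.aeval_C, Polynomial.aeval_X, map_ofNat]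
    field_simp
  have hz1 : a + b * η = a + b * t ^ 2 * (η / t ^ 2) := by
    field_simp
  have := (t ^ 2 • D).mul_apply_mem_of_quadratic k⟮t⟯ h2
    (fun w hw hwO => D.sq_smul_apply_mem hk hi ht0 hDt hw hwO) (η := η / t ^ 2)
    (by rw [div_pow]; exact div_mem hηK (pow_mem (pow_mem htK 2) 2))
    (ValuationSubring.mem_of_sq_mem (hη1 ▸ ValuationSubring.aeval_mem hk hi _)) ha
    (mul_mem hb (pow_mem htK 2)) (hz1 ▸ hz)
  rw [← hz1, Derivation.smul_apply, smul_eq_mul, ← mul_assoc,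
    div_mul_cancel₀ _ (pow_ne_zero 2 ht0)] at this
  exact this

theorem IsCurveDerivation.not_isBiellipticOver [CharZero k] {d : ℕ} {F : MvPolynomial (Fin 3) k}
    (hd : 5 ≤ d) (hF : IsSmoothPlaneCurve d F) {P : Fin 3 → L} {δ : Derivation k L L}
    (h : IsCurveDerivation F P δ)
    (hline : ∀ ℓ : Fin 3 → k, ∑ i, algebraMap k L (ℓ i) * P i = 0 → ℓ = 0)
    (hgen : ∀ σ : L ≃ₐ[k] L, (∀ i, σ (P i) = P i) → ∀ z, σ z = z) :
    ¬ IsBiellipticOver k L := by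
  rintro ⟨W, -, φ, hfr⟩
  have : CharZero L := charZero_of_injective_algebraMap (algebraMap k L).injective
  obtain ⟨σ, hσ, ⟨z₀, hz₀⟩, hfix⟩ := exists_involution_of_finrank_eq_two _ hfr
  obtain ⟨t, η, ht, hη, htK, hηK, hrep⟩ := W.exists_quadratic_of_algHom φ
  have hodd := W.odd_natDegree_twoTorsionPolynomial
  have hη0 : η ≠ 0 := fun h0 => one_ne_zero (α := L)
    (eq_zero_of_sq_mul_aeval_eq ht hodd (one_mem _) (one_mem _) (c := 0) (by simp [← hη, h0]))
  have hzero : ∀ E : Derivation k L L, E t = 0 → ∀ z, E z = 0 := by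
    refine fun E hE => E.eq_zero_of_fixed σ hσ fun w hw => ?_
    have hEη : E η = 0 := by
      have h0 := E.eq_zero_of_mem_adjoin hE (hη ▸ aeval_mem_adjoin_simple t _ : η ^ 2 ∈ k⟮t⟯)
      rw [pow_two, Derivation.leibniz, smul_eq_mul, ← two_mul] at h0
      simpa [hη0] using h0
    obtain ⟨a, ha, b, hb, rfl⟩ := hrep w ((hfix w).1 hw)
    rw [map_add, Derivation.leibniz, hEη, E.eq_zero_of_mem_adjoin hE ha,
      E.eq_zero_of_mem_adjoin hE hb, smul_zero, smul_zero, add_zero, add_zero]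
  have hδt : δ t ≠ 0 := fun h0 => by
    obtain ⟨z, hz⟩ := h.exists_apply_ne_zero hF
    exact hz (hzero δ h0 z)
  have hDt : ((δ t)⁻¹ • δ) t = 1 := by
    rw [Derivation.smul_apply, smul_eq_mul, inv_mul_cancel₀ hδt]
  have hσt : σ t = t := (hfix t).2 htK
  have hση : σ η = η := (hfix η).2 hηK
  have hc : ∀ z, ((η * (δ t)⁻¹) • δ) z = η * ((δ t)⁻¹ • δ) z := fun z => by
    simp only [Derivation.smul_apply, smul_eq_mul, mul_assoc]
  refine h.false_of_involution hd hF hline σ hσ ?_ (mul_ne_zero hη0 (inv_ne_zero hδt)) ?_ ?_ ?_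
  · by_contra! hall
    exact hz₀ (hgen σ hall z₀)
  · intro z
    obtain ⟨E, hE⟩ := ((δ t)⁻¹ • δ).exists_conj_sub σ hσ
    have := hzero E (by rw [hE, hσt, hDt, map_one, sub_self]) (σ z)
    rw [hE, hσ] at this
    rw [hc, hc, map_mul, hση, sub_eq_zero.1 this]
  · intro O hk w hw hσw
    obtain ⟨a, ha, b, hb, rfl⟩ := hrep w ((hfix w).1 hσw)
    rw [hc]
    exact Derivation.mul_apply_mem_of_twoTorsionPolynomial hk W _ hDt hη ha hb hw
  · intro w hσw hi
    obtain ⟨a, ha, b, hb, rfl⟩ := hrep w ((hfix w).1 hσw)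
    exact exists_algebraMap_eq_of_isIntegral_quadratic ht hodd hη ha hb hi

end Bielliptic

/-- **Smooth plane curves of degree `≥ 5` are neither hyperelliptic nor bielliptic.**
Let `C` be a smooth projective plane curve of degree `d ≥ 5` over a number field `k`, with
function field the fraction field of its affine coordinate ring (an integral domain).
Then `C` is neither hyperelliptic over `k` nor bielliptic over `k`. -/
theorem deg_ge_five_not_hyperelliptic_not_bielliptic
    (k : Type) [Field k] [NumberField k]
    (d : ℕ) (hd : 5 ≤ d)
    (F : MvPolynomial (Fin 3) k) (hF : IsSmoothPlaneCurve d F)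
    [IsDomain (PlaneCurveRing k F)] :
    ¬ IsHyperellipticOver k (FractionRing (PlaneCurveRing k F)) ∧
    ¬ IsBiellipticOver k (FractionRing (PlaneCurveRing k F)) := by
  obtain ⟨δ, hδ⟩ := exists_isCurveDerivation hF.1
  exact ⟨hδ.not_isHyperellipticOver hd hF (fun _ => eq_zero_of_sum_mul_curvePoint_eq_zero hd hF)
      fun σ hσ => apply_eq_of_apply_curvePoint_eq σ hσ,
    hδ.not_isBiellipticOver hd hF (fun _ => eq_zero_of_sum_mul_curvePoint_eq_zero hd hF)
      fun σ hσ => apply_eq_of_apply_curvePoint_eq σ hσ⟩
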